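/- arXiv:1411.6149 — 2 statements merged into one kernel-verified Lean document; each statement's English description precedes it below -/
import Mathlib

section
/- Fix k ≥ 3 and let β̄_k = inf_{q∈(0,1)} √( −(1/q^k) log(1−q²) ). For any fixed β with 0 ≤ β < β̄_k, the total variation distance between P_β (the law of X = β v^{⊗k} + Z, with v uniform on the unit sphere S^{n−1} and Z an independent symmetric standard normal k-tensor) and P_0 (the law of Z) converges to 0 as n → ∞. -/
open MeasureTheory ProbabilityTheory Filter
open scoped ENNReal

noncomputable section

/-- Product of i.i.d. standard Gaussians indexed by `ι`. -/
def stdGaussianPi (ι : Type*) [Fintype ι] : Measure (ι → ℝ) :=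
  Measure.pi fun _ => gaussianReal 0 1

/-- The uniform (rotation-invariant) probability measure on the unit sphere `S^{n-1} ⊆ ℝⁿ`,
realized as the law of a normalized standard Gaussian vector. -/
def sphereUniform (n : ℕ) : Measure (EuclideanSpace ℝ (Fin n)) :=
  ((stdGaussianPi (Fin n)).map
      fun x => ((EuclideanSpace.equiv (Fin n) ℝ).symm x : EuclideanSpace ℝ (Fin n))).map
    fun v => ‖v‖⁻¹ • v

/-- Symmetric standard normal noise tensor: `Z = (1/k!)·√(2/n)·Σ_{π∈S_k} G^π`, where `G` has
i.i.d. `N(0,1)` entries and `(G^π)_{i₁…i_k} = G_{i_{π(1)},…,i_{π(k)}}`. -/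
def symNoise (k n : ℕ) : Measure ((Fin k → Fin n) → ℝ) :=
  (stdGaussianPi (Fin k → Fin n)).map
    fun g idx => (1 / (Nat.factorial k : ℝ)) * Real.sqrt (2 / n) *
      ∑ π : Equiv.Perm (Fin k), g (idx ∘ π)

/-- Law of the spiked symmetric tensor `X = β v^{⊗k} + Z`, with `v` uniform on the unit sphere
and `Z` an independent symmetric standard normal tensor. -/
def spikedSymTensor (k n : ℕ) (β : ℝ) : Measure ((Fin k → Fin n) → ℝ) :=
  ((sphereUniform n).prod (symNoise k n)).map
    fun p idx => β * (∏ j, p.1 (idx j)) + p.2 idx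

/-- Total variation distance `‖P − Q‖_TV = sup_A |P(A) − Q(A)|` over measurable sets `A`. -/
def tvDist {Ω : Type*} [MeasurableSpace Ω] (P Q : Measure Ω) : ℝ :=
  ⨆ s : {s : Set Ω // MeasurableSet s}, |(P s).toReal - (Q s).toReal|

/-- The second-moment threshold `β̄_k = inf_{q∈(0,1)} √(−(1/q^k) log(1−q²))`. -/
def betaBar (k : ℕ) : ℝ :=
  sInf {x : ℝ | ∃ q ∈ Set.Ioo (0 : ℝ) 1, x = Real.sqrt (-(1 / q ^ k) * Real.log (1 - q ^ 2))}

lemma lintegral_exp_quadratic_gaussianReal (a b : ℝ) (hb : 0 < 1 + 2 * b) :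
    ∫⁻ x, ENNReal.ofReal (Real.exp (a * x - b * x ^ 2)) ∂gaussianReal 0 1 =
      ENNReal.ofReal ((√(1 + 2 * b))⁻¹ * Real.exp (a ^ 2 / (2 * (1 + 2 * b)))) := by
  have hc : 0 < (1 + 2 * b)⁻¹ := inv_pos.2 hb
  obtain ⟨v, hvc⟩ : ∃ v : NNReal, (v : ℝ) = (1 + 2 * b)⁻¹ :=
    ⟨Real.toNNReal _, Real.coe_toNNReal _ hc.le⟩
  have hv : v ≠ 0 := by
    rintro rfl
    exact hc.ne hvc
  have hpoint : ∀ x : ℝ, gaussianPDF 0 1 x * ENNReal.ofReal (Real.exp (a * x - b * x ^ 2)) =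
      ENNReal.ofReal ((√(1 + 2 * b))⁻¹ * Real.exp (a ^ 2 / (2 * (1 + 2 * b)))) *
        gaussianPDF (a / (1 + 2 * b)) v x := by
    intro x
    rw [gaussianPDF, gaussianPDF, ← ENNReal.ofReal_mul (gaussianPDFReal_nonneg _ _ _),
      ← ENNReal.ofReal_mul (by positivity)]
    congr 1
    simp only [gaussianPDFReal, NNReal.coe_one, hvc]
    have h1 : √(2 * Real.pi * (1 + 2 * b)⁻¹) = √(2 * Real.pi) * (√(1 + 2 * b))⁻¹ := by
      rw [Real.sqrt_mul (by positivity), Real.sqrt_inv]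
    have h2 : Real.exp (-(x - 0) ^ 2 / (2 * 1)) * Real.exp (a * x - b * x ^ 2) =
        Real.exp (a ^ 2 / (2 * (1 + 2 * b))) *
          Real.exp (-(x - a / (1 + 2 * b)) ^ 2 / (2 * (1 + 2 * b)⁻¹)) := by
      rw [← Real.exp_add, ← Real.exp_add]
      congr 1
      field_simp
      ring
    have h3 : 0 < √(1 + 2 * b) := Real.sqrt_pos.2 hb
    have h4 : 0 < √(2 * Real.pi) := by positivity
    rw [h1, mul_one, mul_assoc, h2]
    field_simp
  rw [gaussianReal_of_var_ne_zero _ one_ne_zero,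
    lintegral_withDensity_eq_lintegral_mul _ (measurable_gaussianPDF _ _) (by fun_prop)]
  simp only [Pi.mul_apply, hpoint]
  rw [lintegral_const_mul _ (measurable_gaussianPDF _ _), lintegral_gaussianPDF_eq_one _ hv,
    mul_one]

lemma lintegral_exp_linear_gaussianReal (a : ℝ) :
    ∫⁻ x, ENNReal.ofReal (Real.exp (a * x)) ∂gaussianReal 0 1 =
      ENNReal.ofReal (Real.exp (a ^ 2 / 2)) := by
  simpa using lintegral_exp_quadratic_gaussianReal a 0 (by norm_num)

lemma lintegral_pi_prod {ι : Type*} [Fintype ι] {X : ι → Type*} [∀ i, MeasurableSpace (X i)]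
    (μ : ∀ i, Measure (X i)) [∀ i, IsProbabilityMeasure (μ i)] (f : ∀ i, X i → ℝ≥0∞)
    (hf : ∀ i, Measurable (f i)) :
    ∫⁻ x, ∏ i, f i (x i) ∂Measure.pi μ = ∏ i, ∫⁻ x, f i x ∂μ i := by
  have h := iIndepFun_pi (μ := μ) (X := f) fun i => (hf i).aemeasurable
  have h' := lintegral_prod_eq_prod_lintegral_of_indepFun Finset.univ
    (fun i (x : ∀ i, X i) => f i (x i)) h fun i => (hf i).comp (measurable_pi_apply i)
  rw [h']
  refine Finset.prod_congr rfl fun i _ => ?_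
  exact (measurePreserving_eval μ i).lintegral_comp (hf i)

instance isProbabilityMeasure_stdGaussianPi (ι : Type*) [Fintype ι] :
    IsProbabilityMeasure (stdGaussianPi ι) := by
  unfold stdGaussianPi; infer_instance

lemma lintegral_exp_linear_stdGaussianPi {ι : Type*} [Fintype ι] (w : ι → ℝ) :
    ∫⁻ x, ENNReal.ofReal (Real.exp (∑ i, w i * x i)) ∂stdGaussianPi ι =
      ENNReal.ofReal (Real.exp ((∑ i, w i ^ 2) / 2)) := by
  simp_rw [Real.exp_sum, Finset.sum_div, Real.exp_sum,
    ENNReal.ofReal_prod_of_nonneg fun i _ => (Real.exp_pos _).le]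
  rw [stdGaussianPi, lintegral_pi_prod _ (fun i x => ENNReal.ofReal (Real.exp (w i * x)))
    (fun i => by fun_prop)]
  simp_rw [lintegral_exp_linear_gaussianReal]

lemma gaussianReal_map_add_eq_withDensity (u : ℝ) (s : Set ℝ) (hs : MeasurableSet s) :
    gaussianReal 0 1 ((fun x => u + x) ⁻¹' s) =
      ∫⁻ x in s, ENNReal.ofReal (Real.exp (u * x - u ^ 2 / 2)) ∂gaussianReal 0 1 := by
  rw [← Measure.map_apply (by fun_prop) hs]
  have : (gaussianReal 0 1).map (fun x => u + x) = gaussianReal u 1 := by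
    simpa using gaussianReal_map_const_add (μ := 0) (v := 1) u
  rw [this, gaussianReal_of_var_ne_zero _ one_ne_zero, gaussianReal_of_var_ne_zero _ one_ne_zero,
    withDensity_apply _ hs, restrict_withDensity hs,
    lintegral_withDensity_eq_lintegral_mul _ (measurable_gaussianPDF _ _) (by fun_prop)]
  refine lintegral_congr fun x => ?_
  rw [Pi.mul_apply, gaussianPDF, gaussianPDF, ← ENNReal.ofReal_mul (gaussianPDFReal_nonneg _ _ _)]
  congr 1
  simp only [gaussianPDFReal]
  rw [mul_assoc (√_)⁻¹, ← Real.exp_add]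
  congr 2
  simp
  ring

/-- Cameron–Martin formula for the standard Gaussian product measure. -/
lemma stdGaussianPi_map_add {ι : Type*} [Fintype ι] (u : ι → ℝ) :
    (stdGaussianPi ι).map (fun x => u + x) = (stdGaussianPi ι).withDensity
      fun x => ENNReal.ofReal (Real.exp (∑ i, (u i * x i - u i ^ 2 / 2))) := by
  have h1 : Measure.pi (fun i => (gaussianReal 0 1).map (fun x => u i + x)) =
      (stdGaussianPi ι).map (fun x => u + x) := by
    have (i : ι) : IsProbabilityMeasure ((gaussianReal 0 1).map (fun x => u i + x)) :=
      Measure.isProbabilityMeasure_map (by fun_prop)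
    exact (Measure.pi_map_pi (μ := fun _ : ι => gaussianReal 0 1)
      (f := fun i x => u i + x) (fun i => by fun_prop)).symm
  have (i : ι) : IsProbabilityMeasure ((gaussianReal 0 1).map (fun x => u i + x)) :=
    Measure.isProbabilityMeasure_map (by fun_prop)
  rw [← h1]
  refine Measure.pi_eq fun s hs => ?_
  rw [withDensity_apply _ (MeasurableSet.univ_pi hs), ← lintegral_indicator (.univ_pi hs)]
  have h2 : ∀ x : ι → ℝ, (Set.univ.pi s).indicator
      (fun x => ENNReal.ofReal (Real.exp (∑ i, (u i * x i - u i ^ 2 / 2)))) x =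
      ∏ i, (s i).indicator (fun y => ENNReal.ofReal (Real.exp (u i * y - u i ^ 2 / 2))) (x i) := by
    intro x
    by_cases hx : x ∈ Set.univ.pi s
    · rw [Set.indicator_of_mem hx, Real.exp_sum,
        ENNReal.ofReal_prod_of_nonneg fun i _ => (Real.exp_pos _).le]
      refine Finset.prod_congr rfl fun i _ => ?_
      rw [Set.indicator_of_mem (hx i trivial)]
    · rw [Set.indicator_of_notMem hx]
      simp only [Set.mem_univ_pi, not_forall] at hx
      obtain ⟨i, hi⟩ := hx
      exact (Finset.prod_eq_zero (Finset.mem_univ i) (Set.indicator_of_notMem hi _)).symm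
  simp_rw [h2]
  rw [stdGaussianPi, lintegral_pi_prod _ (fun i => (s i).indicator
    fun y => ENNReal.ofReal (Real.exp (u i * y - u i ^ 2 / 2)))
    (fun i => Measurable.indicator (by fun_prop) (hs i))]
  refine Finset.prod_congr rfl fun i _ => ?_
  rw [lintegral_indicator (hs i), Measure.map_apply (by fun_prop) (hs i),
    gaussianReal_map_add_eq_withDensity _ _ (hs i)]

lemma abs_setLIntegral_sub_le_sqrt {Ω : Type*} [MeasurableSpace Ω] (γ : Measure Ω)
    [IsProbabilityMeasure γ] {L : Ω → ℝ≥0∞} (hL : Measurable L) (hL1 : ∫⁻ x, L x ∂γ = 1)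
    {δ : ℝ} (hδ : 0 ≤ δ) (hL2 : ∫⁻ x, L x ^ 2 ∂γ ≤ ENNReal.ofReal (1 + δ)) (A : Set Ω) :
    |(∫⁻ x in A, L x ∂γ).toReal - (γ A).toReal| ≤ √δ := by
  have hfin : ∀ᵐ x ∂γ, L x < ∞ := ae_lt_top hL (by simp [hL1])
  have hfin2 : ∀ᵐ x ∂γ, L x ^ 2 < ∞ :=
    hfin.mono fun x hx => ENNReal.pow_lt_top hx
  set f : Ω → ℝ := fun x => (L x).toReal with hf
  have hfm : Measurable f := hL.ennreal_toReal
  have hfi : Integrable f γ := integrable_toReal_of_lintegral_ne_top hL.aemeasurable (by simp [hL1])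
  have hf2i : Integrable (fun x => f x ^ 2) γ := by
    simpa [hf, ENNReal.toReal_pow] using
      integrable_toReal_of_lintegral_ne_top (hL.pow_const 2).aemeasurable
        (hL2.trans_lt ENNReal.ofReal_lt_top).ne
  have hint : ∫ x, f x ∂γ = 1 := by
    rw [integral_toReal hL.aemeasurable hfin, hL1, ENNReal.toReal_one]
  have hint2 : ∫ x, f x ^ 2 ∂γ ≤ 1 + δ := by
    have := integral_toReal (hL.pow_const 2).aemeasurable hfin2
    simp only [ENNReal.toReal_pow] at this
    rw [hf, this]
    exact ENNReal.toReal_le_of_le_ofReal (by positivity) hL2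
  have hmem : MemLp (fun x => |f x - 1|) 2 γ :=
    (((memLp_two_iff_integrable_sq hfm.aestronglyMeasurable).2 hf2i).sub (memLp_const 1)).abs
  have hvar := variance_nonneg (fun x => |f x - 1|) γ
  rw [variance_eq_sub hmem] at hvar
  have hsq : γ[(fun x => |f x - 1|) ^ 2] = ∫ x, f x ^ 2 ∂γ - 1 := by
    have : ∀ x, ((fun x => |f x - 1|) ^ 2) x = f x ^ 2 - 2 * f x + 1 := fun x => by
      simp only [Pi.pow_apply, sq_abs]; ring
    simp_rw [this]
    rw [integral_add (f := fun x => f x ^ 2 - 2 * f x) (hf2i.sub (hfi.const_mul 2))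
        (integrable_const _), integral_sub hf2i (hfi.const_mul 2), integral_const_mul, hint]
    simp
    ring
  have hA : (∫⁻ x in A, L x ∂γ).toReal - (γ A).toReal = ∫ x in A, (f x - 1) ∂γ := by
    rw [integral_sub hfi.integrableOn (integrable_const _),
      integral_toReal hL.aemeasurable (ae_restrict_of_ae hfin)]
    simp [Measure.real]
  rw [hA]
  calc |∫ x in A, (f x - 1) ∂γ| ≤ ∫ x in A, |f x - 1| ∂γ := abs_integral_le_integral_abs
    _ ≤ ∫ x, |f x - 1| ∂γ :=
      setIntegral_le_integral (hfi.sub (integrable_const _)).abs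
        (Eventually.of_forall fun x => abs_nonneg _)
    _ ≤ √δ := Real.le_sqrt_of_sq_le (by linarith)

/-- Likelihood ratio at `x` of a standard Gaussian vector shifted by `u`. -/
def gaussianShiftDensity {ι : Type*} [Fintype ι] (u x : ι → ℝ) : ℝ≥0∞ :=
  ENNReal.ofReal (Real.exp (∑ i, (u i * x i - u i ^ 2 / 2)))

lemma Measurable.gaussianShiftDensity {α ι : Type*} [MeasurableSpace α] [Fintype ι]
    {f g : α → ι → ℝ} (hf : Measurable f) (hg : Measurable g) :
    Measurable fun a => gaussianShiftDensity (f a) (g a) := by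
  unfold _root_.gaussianShiftDensity; fun_prop

lemma lintegral_gaussianShiftDensity_mul {ι : Type*} [Fintype ι] (u w : ι → ℝ) :
    ∫⁻ x, gaussianShiftDensity u x * gaussianShiftDensity w x ∂stdGaussianPi ι =
      ENNReal.ofReal (Real.exp (∑ i, u i * w i)) := by
  have h : ∀ x : ι → ℝ, gaussianShiftDensity u x * gaussianShiftDensity w x =
      ENNReal.ofReal (Real.exp (-∑ i, (u i ^ 2 / 2 + w i ^ 2 / 2))) *
        ENNReal.ofReal (Real.exp (∑ i, (u i + w i) * x i)) := by
    intro x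
    rw [gaussianShiftDensity, gaussianShiftDensity, ← ENNReal.ofReal_mul (Real.exp_pos _).le,
      ← ENNReal.ofReal_mul (Real.exp_pos _).le, ← Real.exp_add, ← Real.exp_add,
      ← Finset.sum_neg_distrib, ← Finset.sum_add_distrib, ← Finset.sum_add_distrib]
    congr 3 with i
    ring
  simp_rw [h]
  rw [lintegral_const_mul _ (by fun_prop), lintegral_exp_linear_stdGaussianPi,
    ← ENNReal.ofReal_mul (Real.exp_pos _).le, ← Real.exp_add, Finset.sum_div,
    ← Finset.sum_neg_distrib, ← Finset.sum_add_distrib]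
  congr 3 with i
  ring

lemma map_prod_add_stdGaussianPi_apply {Ω ι : Type*} [MeasurableSpace Ω] [Fintype ι]
    (μ : Measure Ω) [IsProbabilityMeasure μ] {u : Ω → ι → ℝ} (hu : Measurable u)
    {A : Set (ι → ℝ)} (hA : MeasurableSet A) :
    ((μ.prod (stdGaussianPi ι)).map fun p => u p.1 + p.2) A =
      ∫⁻ x in A, ∫⁻ ω, gaussianShiftDensity (u ω) x ∂μ ∂stdGaussianPi ι := by
  have hm : Measurable fun p : Ω × (ι → ℝ) => u p.1 + p.2 := by fun_prop
  rw [Measure.map_apply hm hA, Measure.prod_apply (hm hA), lintegral_lintegral_swap]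
  · refine lintegral_congr fun ω => ?_
    have := congrArg (fun ν => ν A) (stdGaussianPi_map_add (u ω))
    simp only [withDensity_apply _ hA] at this
    rw [Measure.map_apply (by fun_prop) hA] at this
    exact this
  · exact ((hu.comp measurable_snd).gaussianShiftDensity measurable_fst).aemeasurable

lemma lintegral_sq_gaussianShiftDensity {Ω ι : Type*} [MeasurableSpace Ω] [Fintype ι]
    (μ : Measure Ω) [IsProbabilityMeasure μ] {u : Ω → ι → ℝ} (hu : Measurable u) :
    ∫⁻ x, (∫⁻ ω, gaussianShiftDensity (u ω) x ∂μ) ^ 2 ∂stdGaussianPi ι =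
      ∫⁻ ω, ∫⁻ ω', ENNReal.ofReal (Real.exp (∑ i, u ω i * u ω' i)) ∂μ ∂μ := by
  have hD : Measurable fun p : (ι → ℝ) × Ω => gaussianShiftDensity (u p.2) p.1 :=
    (hu.comp measurable_snd).gaussianShiftDensity measurable_fst
  have hL : Measurable fun x => ∫⁻ ω, gaussianShiftDensity (u ω) x ∂μ := hD.lintegral_prod_right'
  have hDx : ∀ x, Measurable fun ω => gaussianShiftDensity (u ω) x := fun x =>
    hu.gaussianShiftDensity measurable_const
  have hDω : ∀ ω, Measurable fun x => gaussianShiftDensity (u ω) x := fun ω =>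
    measurable_const.gaussianShiftDensity measurable_id
  calc ∫⁻ x, (∫⁻ ω, gaussianShiftDensity (u ω) x ∂μ) ^ 2 ∂stdGaussianPi ι
      = ∫⁻ x, ∫⁻ ω, gaussianShiftDensity (u ω) x *
          (∫⁻ ω', gaussianShiftDensity (u ω') x ∂μ) ∂μ ∂stdGaussianPi ι := by
        refine lintegral_congr fun x => ?_
        rw [lintegral_mul_const _ (hDx x), sq]
    _ = ∫⁻ ω, ∫⁻ x, gaussianShiftDensity (u ω) x *
          (∫⁻ ω', gaussianShiftDensity (u ω') x ∂μ) ∂stdGaussianPi ι ∂μ :=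
        lintegral_lintegral_swap (hD.mul (hL.comp measurable_fst)).aemeasurable
    _ = ∫⁻ ω, ∫⁻ x, ∫⁻ ω', gaussianShiftDensity (u ω) x *
          gaussianShiftDensity (u ω') x ∂μ ∂stdGaussianPi ι ∂μ := by
        refine lintegral_congr fun ω => lintegral_congr fun x => ?_
        rw [lintegral_const_mul _ (hDx x)]
    _ = ∫⁻ ω, ∫⁻ ω', ∫⁻ x, gaussianShiftDensity (u ω) x *
          gaussianShiftDensity (u ω') x ∂stdGaussianPi ι ∂μ ∂μ := by
        refine lintegral_congr fun ω => lintegral_lintegral_swap ?_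
        exact (((hDω ω).comp measurable_fst).mul hD).aemeasurable
    _ = _ := by simp_rw [lintegral_gaussianShiftDensity_mul]

lemma abs_map_prod_add_stdGaussianPi_sub_le {Ω ι : Type*} [MeasurableSpace Ω] [Fintype ι]
    (μ : Measure Ω) [IsProbabilityMeasure μ] {u : Ω → ι → ℝ} (hu : Measurable u) {δ : ℝ}
    (hδ : 0 ≤ δ)
    (h : ∫⁻ ω, ∫⁻ ω', ENNReal.ofReal (Real.exp (∑ i, u ω i * u ω' i)) ∂μ ∂μ ≤
      ENNReal.ofReal (1 + δ)) {A : Set (ι → ℝ)} (hA : MeasurableSet A) :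
    |(((μ.prod (stdGaussianPi ι)).map fun p => u p.1 + p.2) A).toReal -
      (stdGaussianPi ι A).toReal| ≤ √δ := by
  have hm : Measurable fun p : Ω × (ι → ℝ) => u p.1 + p.2 := by fun_prop
  have hD : Measurable fun p : (ι → ℝ) × Ω => gaussianShiftDensity (u p.2) p.1 :=
    (hu.comp measurable_snd).gaussianShiftDensity measurable_fst
  have hL : Measurable fun x => ∫⁻ ω, gaussianShiftDensity (u ω) x ∂μ := hD.lintegral_prod_right'
  rw [map_prod_add_stdGaussianPi_apply μ hu hA]
  refine abs_setLIntegral_sub_le_sqrt _ hL ?_ hδ ?_ A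
  · rw [← setLIntegral_univ, ← map_prod_add_stdGaussianPi_apply μ hu .univ]
    have := Measure.isProbabilityMeasure_map (μ := μ.prod (stdGaussianPi ι)) hm.aemeasurable
    exact measure_univ
  · rwa [lintegral_sq_gaussianShiftDensity μ hu]

lemma lintegral_exp_sq_sub_stdGaussianPi {ι : Type*} [Fintype ι] {e : ι → ℝ}
    (he : ∑ i, e i ^ 2 = 1) {s q : ℝ} (hs : 0 ≤ s) (hsq : s < 1 + s * q ^ 2) :
    ∫⁻ x, ENNReal.ofReal (Real.exp (s / 2 * ((∑ i, e i * x i) ^ 2 - q ^ 2 * ∑ i, x i ^ 2)))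
        ∂stdGaussianPi ι =
      ENNReal.ofReal ((√(1 + s * q ^ 2))⁻¹ ^ Fintype.card ι *
        (√(1 - s / (1 + s * q ^ 2)))⁻¹) := by
  have hD : 0 < 1 + s * q ^ 2 := by positivity
  set D := 1 + s * q ^ 2 with hDdef
  have hlin : ∀ x : ι → ℝ,
      ENNReal.ofReal (Real.exp (s / 2 * ((∑ i, e i * x i) ^ 2 - q ^ 2 * ∑ i, x i ^ 2))) =
      ∫⁻ h, ∏ i, ENNReal.ofReal (Real.exp (√s * h * e i * x i - s * q ^ 2 / 2 * x i ^ 2))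
        ∂gaussianReal 0 1 := by
    intro x
    have h1 : ∀ h : ℝ,
        ∏ i, ENNReal.ofReal (Real.exp (√s * h * e i * x i - s * q ^ 2 / 2 * x i ^ 2)) =
        ENNReal.ofReal (Real.exp (-(s * q ^ 2 / 2 * ∑ i, x i ^ 2))) *
          ENNReal.ofReal (Real.exp (√s * (∑ i, e i * x i) * h)) := by
      intro h
      rw [← ENNReal.ofReal_prod_of_nonneg fun i _ => (Real.exp_pos _).le, ← Real.exp_sum,
        ← ENNReal.ofReal_mul (Real.exp_pos _).le, ← Real.exp_add, Finset.sum_sub_distrib,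
        Finset.mul_sum, Finset.mul_sum, Finset.sum_mul, neg_add_eq_sub]
      congr 3
      exact Finset.sum_congr rfl fun i _ => by ring
    simp_rw [h1]
    rw [lintegral_const_mul _ (by fun_prop), lintegral_exp_linear_gaussianReal,
      ← ENNReal.ofReal_mul (Real.exp_pos _).le, ← Real.exp_add, mul_pow, Real.sq_sqrt hs]
    congr 2
    ring
  simp_rw [hlin]
  rw [lintegral_lintegral_swap (by fun_prop)]
  have hin : ∀ h : ℝ, ∫⁻ x : ι → ℝ,
      ∏ i, ENNReal.ofReal (Real.exp (√s * h * e i * x i - s * q ^ 2 / 2 * x i ^ 2))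
        ∂stdGaussianPi ι =
      ENNReal.ofReal ((√D)⁻¹ ^ Fintype.card ι) *
        ENNReal.ofReal (Real.exp (0 * h - -(s / (2 * D)) * h ^ 2)) := by
    intro h
    rw [stdGaussianPi, lintegral_pi_prod _ (fun i y =>
      ENNReal.ofReal (Real.exp (√s * h * e i * y - s * q ^ 2 / 2 * y ^ 2)))
      (fun i => by fun_prop)]
    have h2 : 1 + 2 * (s * q ^ 2 / 2) = D := by rw [hDdef]; ring
    simp_rw [lintegral_exp_quadratic_gaussianReal _ (s * q ^ 2 / 2) (h2 ▸ hD), h2]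
    rw [← ENNReal.ofReal_prod_of_nonneg fun i _ => by positivity,
      ← ENNReal.ofReal_mul (by positivity), Finset.prod_mul_distrib, Finset.prod_const,
      Finset.card_univ, ← Real.exp_sum]
    congr 3
    simp_rw [mul_pow, Real.sq_sqrt hs]
    rw [← Finset.sum_div, ← Finset.mul_sum, he]
    field_simp
    ring
  simp_rw [hin]
  have h3 : 1 + 2 * -(s / (2 * D)) = 1 - s / D := by field_simp; ring
  have h4 : 0 < 1 - s / D := by rw [sub_pos, div_lt_one hD]; exact hsq
  rw [lintegral_const_mul _ (by fun_prop),
    lintegral_exp_quadratic_gaussianReal _ _ (h3 ▸ h4), h3,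
    ← ENNReal.ofReal_mul (by positivity)]
  simp

/-- Chernoff bound for the measure of a double cone around the direction `e`. -/
lemma stdGaussianPi_cone_le {ι : Type*} [Fintype ι] [Nonempty ι] {e : ι → ℝ}
    (he : ∑ i, e i ^ 2 = 1) {θ q : ℝ} (hθ0 : 0 < θ) (hθ1 : θ < 1) (hq0 : 0 < q) (hq1 : q < 1) :
    stdGaussianPi ι {x | q ^ 2 * ∑ i, x i ^ 2 ≤ (∑ i, e i * x i) ^ 2} ≤
      ENNReal.ofReal ((√(1 - θ))⁻¹ *
        Real.exp (θ * (Fintype.card ι - 1) / 2 * Real.log (1 - q ^ 2))) := by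
  have hq : 0 < 1 - q ^ 2 := by nlinarith
  set s := θ / (1 - q ^ 2) with hs
  have hs0 : 0 < s := by positivity
  have hD : 1 + s * q ^ 2 = s + (1 - θ) := by rw [hs]; field_simp; ring
  have hD1 : 0 < 1 + s * q ^ 2 := by positivity
  calc stdGaussianPi ι {x | q ^ 2 * ∑ i, x i ^ 2 ≤ (∑ i, e i * x i) ^ 2}
      = ∫⁻ x, {x | q ^ 2 * ∑ i, x i ^ 2 ≤ (∑ i, e i * x i) ^ 2}.indicator 1 x
          ∂stdGaussianPi ι := by
        rw [lintegral_indicator_one (measurableSet_le (by fun_prop) (by fun_prop))]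
    _ ≤ ∫⁻ x, ENNReal.ofReal
          (Real.exp (s / 2 * ((∑ i, e i * x i) ^ 2 - q ^ 2 * ∑ i, x i ^ 2)))
          ∂stdGaussianPi ι := by
        refine lintegral_mono (Set.indicator_le fun x hx => ?_)
        rw [Pi.one_apply, ENNReal.one_le_ofReal, Real.one_le_exp_iff]
        exact mul_nonneg (by positivity) (sub_nonneg.2 hx)
    _ = ENNReal.ofReal ((√(1 + s * q ^ 2))⁻¹ ^ Fintype.card ι *
        (√(1 - s / (1 + s * q ^ 2)))⁻¹) :=
        lintegral_exp_sq_sub_stdGaussianPi he hs0.le (by linarith)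
    _ ≤ _ := by
        refine ENNReal.ofReal_le_ofReal ?_
        have h1 : 1 - s / (1 + s * q ^ 2) = (1 - θ) / (1 + s * q ^ 2) := by
          rw [one_sub_div hD1.ne', hD]; ring
        have h2 : √(1 + s * q ^ 2) = Real.exp (Real.log (1 + s * q ^ 2) / 2) := by
          rw [Real.exp_half, Real.exp_log hD1]
        have h3 : -(θ * Real.log (1 - q ^ 2)) ≤ Real.log (1 + s * q ^ 2) := by
          have hb := rpow_one_add_le_one_add_mul_self (s := q ^ 2 / (1 - q ^ 2))
            (by have : 0 ≤ q ^ 2 / (1 - q ^ 2) := by positivity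
                linarith) hθ0.le hθ1.le
          have h5 : 1 + q ^ 2 / (1 - q ^ 2) = (1 - q ^ 2)⁻¹ := by field_simp; ring
          have h6 : 1 + θ * (q ^ 2 / (1 - q ^ 2)) = 1 + s * q ^ 2 := by rw [hs]; ring
          rw [h5, h6] at hb
          have := Real.log_le_log (by positivity) hb
          rwa [Real.log_rpow (by positivity), Real.log_inv, mul_neg] at this
        have hcard : (1 : ℝ) ≤ Fintype.card ι := by exact_mod_cast Fintype.card_pos
        rw [h1, Real.sqrt_div (by linarith), inv_div, h2, ← Real.exp_neg, ← Real.exp_nat_mul,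
          ← mul_div_assoc, ← Real.exp_add, div_eq_inv_mul]
        refine mul_le_mul_of_nonneg_left (Real.exp_le_exp.2 ?_) (by positivity)
        nlinarith

/-- The vector `x` rescaled to Euclidean norm one (and `0` if `x = 0`). -/
def normalizedVector {n : ℕ} (x : Fin n → ℝ) : EuclideanSpace ℝ (Fin n) :=
  ‖WithLp.toLp 2 x‖⁻¹ • WithLp.toLp 2 x

lemma measurable_normalizedVector {n : ℕ} :
    Measurable (normalizedVector : (Fin n → ℝ) → EuclideanSpace ℝ (Fin n)) := by
  unfold normalizedVector; fun_prop

lemma normalizedVector_apply {n : ℕ} (x : Fin n → ℝ) (i : Fin n) :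
    normalizedVector x i = (√(∑ i, x i ^ 2))⁻¹ * x i := by
  simp [normalizedVector, EuclideanSpace.norm_eq]

lemma sum_sq_normalizedVector {n : ℕ} {x : Fin n → ℝ} (hx : 0 < ∑ i, x i ^ 2) :
    ∑ i, normalizedVector x i ^ 2 = 1 := by
  simp_rw [normalizedVector_apply, mul_pow]
  rw [← Finset.mul_sum, inv_pow, Real.sq_sqrt hx.le, inv_mul_cancel₀ hx.ne']

lemma normalizedVector_eq_zero {n : ℕ} {x : Fin n → ℝ} (hx : ¬ 0 < ∑ i, x i ^ 2) (i : Fin n) :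
    normalizedVector x i = 0 := by
  rw [normalizedVector_apply, Real.sqrt_eq_zero_of_nonpos (not_lt.1 hx), inv_zero, zero_mul]

/-- Tail bound for the overlap of two normalized vectors, one of them fixed. -/
lemma stdGaussianPi_overlap_le {n : ℕ} (hn : n ≠ 0) (y : Fin n → ℝ) {θ q : ℝ} (hθ0 : 0 < θ)
    (hθ1 : θ < 1) (hq0 : 0 < q) (hq1 : q < 1) :
    stdGaussianPi (Fin n) {x | q ≤ |∑ i, normalizedVector y i * normalizedVector x i|} ≤
      ENNReal.ofReal ((√(1 - θ))⁻¹ *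
        Real.exp (θ * (n - 1) / 2 * Real.log (1 - q ^ 2))) := by
  have : NeZero n := ⟨hn⟩
  by_cases hy : 0 < ∑ i, y i ^ 2
  · have h := stdGaussianPi_cone_le (sum_sq_normalizedVector hy) hθ0 hθ1 hq0 hq1
    rw [Fintype.card_fin] at h
    refine le_trans (measure_mono fun x hx => ?_) h
    simp only [Set.mem_ofPred_eq] at hx ⊢
    by_cases hx0 : 0 < ∑ i, x i ^ 2
    · have h1 : ∑ i, normalizedVector y i * normalizedVector x i =
          (√(∑ i, x i ^ 2))⁻¹ * ∑ i, normalizedVector y i * x i := by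
        rw [Finset.mul_sum]
        refine Finset.sum_congr rfl fun i _ => ?_
        rw [normalizedVector_apply x]; ring
      have h2 : q ^ 2 ≤ (∑ i, normalizedVector y i * normalizedVector x i) ^ 2 := by
        rw [← sq_abs (∑ i, _)]; gcongr
      rwa [h1, mul_pow, inv_pow, Real.sq_sqrt hx0.le, le_inv_mul_iff₀ hx0, mul_comm] at h2
    · simp only [normalizedVector_eq_zero hx0, mul_zero, Finset.sum_const_zero, abs_zero] at hx
      linarith
  · simp only [normalizedVector_eq_zero hy, zero_mul, Finset.sum_const_zero, abs_zero,
      not_le.2 hq0, Set.ofPred_false, measure_empty, zero_le]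

/-- Layer-cake bound for exponential moments of `|T|^k` from a tail bound for `T`. -/
lemma lintegral_exp_abs_pow_sub_one_le {Ω : Type*} [MeasurableSpace Ω] (γ : Measure Ω)
    {T : Ω → ℝ} (hT : Measurable T) {C m b c p : ℝ} {k : ℕ} (hk : k ≠ 0) (hC : 0 ≤ C)
    (hm : 0 < m) (hb : 0 < b)
    (htail : ∀ q : ℝ, 0 < q → q < 1 →
      γ {ω | q ≤ |T ω|} ≤ ENNReal.ofReal (C * Real.exp (m * Real.log (1 - q ^ 2))))
    (hc : ∀ q : ℝ, 0 < q → q < 1 → c * q ^ k ≤ -Real.log (1 - q ^ 2))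
    (hp : p * b ≤ m * c) :
    ∫⁻ ω, ENNReal.ofReal (Real.exp (b * |T ω| ^ k) - 1) ∂γ ≤
      ∫⁻ s in Set.Ioi (0 : ℝ), ENNReal.ofReal (min (C * (s + 1) ^ (-p))
        (C * Real.exp (-(m * (Real.log (s + 1) / b) ^ (2 / (k : ℝ)))))) := by
  have hk0 : (0 : ℝ) < k := by positivity
  rw [lintegral_eq_lintegral_meas_le γ (f := fun ω => Real.exp (b * |T ω| ^ k) - 1)
    (Eventually.of_forall fun ω => by
      simp only [Pi.zero_apply, sub_nonneg, Real.one_le_exp_iff]; positivity) (by fun_prop)]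
  refine setLIntegral_mono' measurableSet_Ioi fun s hs => ?_
  have hs : (0 : ℝ) < s := hs
  have hlog : 0 < Real.log (s + 1) := Real.log_pos (by linarith)
  set r := Real.log (s + 1) / b with hr
  have hr0 : 0 < r := by positivity
  set q := r ^ (1 / (k : ℝ)) with hq
  have hq0 : 0 < q := by positivity
  have hqk : q ^ k = r := by
    rw [hq, ← Real.rpow_natCast, ← Real.rpow_mul hr0.le, one_div_mul_cancel hk0.ne',
      Real.rpow_one]
  have hq2 : r ^ (2 / (k : ℝ)) = q ^ 2 := by
    rw [hq, ← Real.rpow_natCast, ← Real.rpow_mul hr0.le]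
    congr 1
    push_cast
    ring
  have hsub : {ω | s ≤ Real.exp (b * |T ω| ^ k) - 1} ⊆ {ω | q ≤ |T ω|} := by
    intro ω hω
    simp only [Set.mem_ofPred_eq] at hω ⊢
    have h1 : Real.log (s + 1) ≤ b * |T ω| ^ k := by
      rw [Real.log_le_iff_le_exp (by linarith)]; linarith
    have h2 : q ^ k ≤ |T ω| ^ k := by
      rw [hqk, hr, div_le_iff₀ hb]; linarith
    exact le_of_pow_le_pow_left₀ hk (abs_nonneg _) h2
  refine (measure_mono hsub).trans ?_
  rw [hq2]
  rcases lt_or_ge q 1 with hq1 | hq1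
  · refine (htail q hq0 hq1).trans (ENNReal.ofReal_le_ofReal (le_min ?_ ?_))
    · refine mul_le_mul_of_nonneg_left ?_ hC
      rw [Real.rpow_def_of_pos (by linarith)]
      refine Real.exp_le_exp.2 ?_
      have h1 := mul_le_mul_of_nonneg_left (hc q hq0 hq1) hm.le
      have h2 : Real.log (s + 1) = q ^ k * b := by rw [hqk, hr]; field_simp
      have h3 : p * b * q ^ k ≤ m * c * q ^ k := by gcongr
      rw [h2]
      linarith
    · refine mul_le_mul_of_nonneg_left (Real.exp_le_exp.2 ?_) hC
      have h1 : 0 < 1 - q ^ 2 := by nlinarith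
      have := Real.log_le_sub_one_of_pos h1
      nlinarith
  · have hzero : γ {ω | q ≤ |T ω|} ≤ 0 := by
      have hlim : Tendsto (fun ε : ℝ => ENNReal.ofReal (C * Real.exp (m * Real.log ε)))
          (nhdsWithin 0 (Set.Ioi 0)) (nhds 0) := by
        have h1 := Real.tendsto_exp_atBot.comp
          (Real.tendsto_log_nhdsGT_zero.const_mul_atBot hm)
        simpa using ENNReal.tendsto_ofReal (h1.const_mul C)
      refine ge_of_tendsto hlim ?_
      filter_upwards [Ioo_mem_nhdsGT (zero_lt_one' ℝ)] with ε hε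
      have hε' : (0 : ℝ) ≤ 1 - ε := by linarith [hε.2]
      have h2 := htail (√(1 - ε)) (Real.sqrt_pos.2 (by linarith [hε.2]))
        (by rw [Real.sqrt_lt' one_pos]; linarith [hε.1])
      rw [Real.sq_sqrt hε', sub_sub_cancel] at h2
      refine (measure_mono fun ω hω => ?_).trans h2
      exact (Real.sqrt_le_one.2 (by linarith [hε.1])).trans (hq1.trans hω)
    exact hzero.trans zero_le

/-- The tail bounds integrate to a quantity that vanishes as the dimension grows. -/
lemma tendsto_lintegral_tail_bound {k : ℕ} (hk : 3 ≤ k) {C θ B p : ℝ} (hθ : 0 < θ)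
    (hB : 0 < B) (hp : 1 < p) :
    Tendsto (fun n : ℕ => ∫⁻ s in Set.Ioi (0 : ℝ), ENNReal.ofReal (min (C * (s + 1) ^ (-p))
      (C * Real.exp (-(θ * (n - 1) / 2 * (Real.log (s + 1) / (n * B)) ^ (2 / (k : ℝ)))))))
      atTop (nhds 0) := by
  have hk0 : (0 : ℝ) < k := by positivity
  have hint : IntegrableOn (fun s : ℝ => C * (s + 1) ^ (-p)) (Set.Ioi 0) :=
    (integrableOn_add_rpow_Ioi_of_lt (by linarith) (by norm_num)).const_mul C
  have h := tendsto_lintegral_filter_of_dominated_convergence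
    (μ := volume.restrict (Set.Ioi (0 : ℝ))) (l := atTop)
    (F := fun (n : ℕ) s => ENNReal.ofReal (min (C * (s + 1) ^ (-p))
      (C * Real.exp (-(θ * (n - 1) / 2 * (Real.log (s + 1) / (n * B)) ^ (2 / (k : ℝ)))))))
    (f := fun _ => 0) (fun s => ENNReal.ofReal (C * (s + 1) ^ (-p)))
    (Eventually.of_forall fun n => by fun_prop)
    (Eventually.of_forall fun n => Eventually.of_forall fun s =>
      ENNReal.ofReal_le_ofReal (min_le_left _ _)) ?_ ?_
  · simpa using h
  · exact hint.lintegral_lt_top.ne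
  · refine (ae_restrict_mem measurableSet_Ioi).mono fun s hs => ?_
    have hs : (0 : ℝ) < s := hs
    have hlog : 0 < Real.log (s + 1) := Real.log_pos (by linarith)
    set r := Real.log (s + 1) / B with hr
    have hr0 : 0 < r := by positivity
    have hpow : Tendsto (fun n : ℕ => θ / 4 * r ^ (2 / (k : ℝ)) * (n : ℝ) ^ (1 - 2 / (k : ℝ)))
        atTop atTop := by
      refine Tendsto.const_mul_atTop (by positivity)
        ((tendsto_rpow_atTop ?_).comp tendsto_natCast_atTop_atTop)
      rw [sub_pos, div_lt_one hk0]
      exact_mod_cast hk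
    have hexp : Tendsto (fun n : ℕ =>
        θ * (n - 1) / 2 * (Real.log (s + 1) / (n * B)) ^ (2 / (k : ℝ))) atTop atTop := by
      refine tendsto_atTop_mono' _ ?_ hpow
      filter_upwards [eventually_ge_atTop 2] with n hn
      have hn2 : (2 : ℝ) ≤ n := by exact_mod_cast hn
      have hn0 : (0 : ℝ) < n := by linarith
      have h1 : Real.log (s + 1) / (n * B) = r / n := by rw [hr]; field_simp
      rw [h1, Real.div_rpow hr0.le hn0.le, Real.rpow_sub hn0, Real.rpow_one]
      have h2 : θ / 4 * r ^ (2 / (k : ℝ)) * (n / (n : ℝ) ^ (2 / (k : ℝ))) =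
          θ * n / 4 * (r ^ (2 / (k : ℝ)) / (n : ℝ) ^ (2 / (k : ℝ))) := by ring
      rw [h2]
      refine mul_le_mul_of_nonneg_right ?_ (by positivity)
      nlinarith
    have h1 : Tendsto (fun n : ℕ => ENNReal.ofReal (C * Real.exp
        (-(θ * (n - 1) / 2 * (Real.log (s + 1) / (n * B)) ^ (2 / (k : ℝ)))))) atTop (nhds 0) := by
      have := Real.tendsto_exp_atBot.comp (tendsto_neg_atTop_atBot.comp hexp)
      simpa using ENNReal.tendsto_ofReal (this.const_mul C)
    exact tendsto_of_tendsto_of_tendsto_of_le_of_le tendsto_const_nhds h1 (fun _ => zero_le)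
      fun n => ENNReal.ofReal_le_ofReal (min_le_right _ _)

lemma mul_pow_le_neg_log_of_le_betaBar {k : ℕ} {β q : ℝ} (hβ0 : 0 ≤ β) (hβ : β ≤ betaBar k)
    (hq0 : 0 < q) (hq1 : q < 1) : β ^ 2 * q ^ k ≤ -Real.log (1 - q ^ 2) := by
  have hle : betaBar k ≤ √(-(1 / q ^ k) * Real.log (1 - q ^ 2)) := by
    refine csInf_le ⟨0, ?_⟩ ⟨q, ⟨hq0, hq1⟩, rfl⟩
    rintro x ⟨q, -, rfl⟩
    exact Real.sqrt_nonneg _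
  have hqk : 0 < q ^ k := by positivity
  have hnn : 0 ≤ -(1 / q ^ k) * Real.log (1 - q ^ 2) :=
    mul_nonneg_of_nonpos_of_nonpos (by simpa using hqk.le)
      (Real.log_nonpos (by nlinarith) (by nlinarith))
  have h := mul_le_mul_of_nonneg_right ((Real.le_sqrt hβ0 hnn).1 (hβ.trans hle)) hqk.le
  refine h.trans_eq ?_
  field_simp

/-- The bound on the excess exponential moment of the overlap obtained from the overlap tail bounds. -/
def overlapTailBound (k : ℕ) (C θ B p : ℝ) (n : ℕ) : ℝ≥0∞ :=
  ∫⁻ s in Set.Ioi (0 : ℝ), ENNReal.ofReal (min (C * (s + 1) ^ (-p))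
    (C * Real.exp (-(θ * (n - 1) / 2 * (Real.log (s + 1) / (n * B)) ^ (2 / (k : ℝ))))))

lemma lintegral_exp_overlap_sub_one_le {k : ℕ} (hk : k ≠ 0) {b₁ b₂ θ p : ℝ} (hb₁ : 0 < b₁)
    (hb₂0 : 0 ≤ b₂) (hb₂ : b₂ ≤ betaBar k) (hθ0 : 0 < θ) (hθ1 : θ < 1) {n : ℕ} (hn : 2 ≤ n)
    (hp : p * (n * b₁ ^ 2) ≤ θ * (n - 1) * b₂ ^ 2) (y : Fin n → ℝ) :
    ∫⁻ x, ENNReal.ofReal (Real.exp (n * (b₁ ^ 2 / 2) *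
        |∑ i, normalizedVector y i * normalizedVector x i| ^ k) - 1) ∂stdGaussianPi (Fin n) ≤
      overlapTailBound k (√(1 - θ))⁻¹ θ (b₁ ^ 2 / 2) p n := by
  have hn2 : (2 : ℝ) ≤ n := by exact_mod_cast hn
  refine lintegral_exp_abs_pow_sub_one_le (c := b₂ ^ 2) (stdGaussianPi (Fin n))
    (T := fun x => ∑ i, normalizedVector y i * normalizedVector x i) ?_ hk (by positivity)
    (by nlinarith) (by positivity) ?_ ?_ (by linarith)
  · have := measurable_normalizedVector (n := n)
    fun_prop
  · exact fun q hq0 hq1 => stdGaussianPi_overlap_le (by omega) y hθ0 hθ1 hq0 hq1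
  · exact fun q hq0 hq1 => mul_pow_le_neg_log_of_le_betaBar hb₂0 hb₂ hq0 hq1

/-- The symmetrization map carrying a tensor `G` to `(1/k!)·√(2/n)·Σ_π G^π`. -/
def scaledSymmetrize (k n : ℕ) (g : (Fin k → Fin n) → ℝ) (idx : Fin k → Fin n) : ℝ :=
  (1 / (Nat.factorial k : ℝ)) * Real.sqrt (2 / n) * ∑ π : Equiv.Perm (Fin k), g (idx ∘ π)

lemma measurable_scaledSymmetrize (k n : ℕ) : Measurable (scaledSymmetrize k n) := by
  unfold scaledSymmetrize; fun_prop

/-- The rank-one spike, scaled so that `scaledSymmetrize` maps it to `β v^{⊗k}`. -/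
def spike (k : ℕ) {n : ℕ} (β : ℝ) (v : EuclideanSpace ℝ (Fin n)) (idx : Fin k → Fin n) : ℝ :=
  β * √(n / 2) * ∏ j, v (idx j)

lemma sum_spike_mul_spike (k : ℕ) {n : ℕ} (β : ℝ) (v w : EuclideanSpace ℝ (Fin n)) :
    ∑ idx, spike k β v idx * spike k β w idx = n * (β ^ 2 / 2) * (∑ i, v i * w i) ^ k := by
  rw [Fintype.sum_pow, Finset.mul_sum]
  refine Finset.sum_congr rfl fun idx _ => ?_
  have h : √((n : ℝ) / 2) * √((n : ℝ) / 2) = n / 2 := Real.mul_self_sqrt (by positivity)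
  rw [spike, spike, Finset.prod_mul_distrib]
  linear_combination β ^ 2 * (∏ j, v (idx j)) * (∏ j, w (idx j)) * h

lemma scaledSymmetrize_spike_add {k n : ℕ} (hn : n ≠ 0) (β : ℝ) (v : EuclideanSpace ℝ (Fin n))
    (g : (Fin k → Fin n) → ℝ) (idx : Fin k → Fin n) :
    scaledSymmetrize k n (spike k β v + g) idx =
      β * (∏ j, v (idx j)) + scaledSymmetrize k n g idx := by
  have hn0 : (0 : ℝ) < n := by positivity
  have h1 : √(2 / (n : ℝ)) * √((n : ℝ) / 2) = 1 := by
    rw [← Real.sqrt_mul (by positivity)]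
    field_simp
    simp
  have h2 : ∀ π : Equiv.Perm (Fin k), spike k β v (idx ∘ π) = spike k β v idx := fun π => by
    simp only [spike, Function.comp_apply]
    rw [Equiv.prod_comp π fun j => v (idx j)]
  have h3 : (Nat.factorial k : ℝ) ≠ 0 := by positivity
  simp only [scaledSymmetrize, Pi.add_apply, Finset.sum_add_distrib, h2, Finset.sum_const,
    Finset.card_univ, Fintype.card_perm, Fintype.card_fin, nsmul_eq_mul, mul_add]
  rw [spike]
  congr 1
  calc _ = (1 / (Nat.factorial k : ℝ) * Nat.factorial k) * (√(2 / (n : ℝ)) * √((n : ℝ) / 2)) *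
        (β * ∏ j, v (idx j)) := by ring
    _ = _ := by rw [h1, one_div_mul_cancel h3, one_mul, one_mul]

lemma measurable_spike_normalizedVector (k n : ℕ) (β : ℝ) :
    Measurable fun x : Fin n → ℝ => spike k β (normalizedVector x) := by
  have := measurable_normalizedVector (n := n)
  unfold spike
  fun_prop

lemma spikedSymTensor_eq_map {k n : ℕ} (hn : n ≠ 0) (β : ℝ) :
    spikedSymTensor k n β =
      (((stdGaussianPi (Fin n)).prod (stdGaussianPi (Fin k → Fin n))).map
        fun p => spike k β (normalizedVector p.1) + p.2).map (scaledSymmetrize k n) := by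
  have hS : sphereUniform n = (stdGaussianPi (Fin n)).map normalizedVector := by
    rw [sphereUniform, Measure.map_map (by fun_prop) (by fun_prop)]
    rfl
  have hN : symNoise k n = (stdGaussianPi (Fin k → Fin n)).map (scaledSymmetrize k n) := rfl
  have hspike := measurable_spike_normalizedVector k n β
  have hT := measurable_scaledSymmetrize k n
  have hadd : Measurable fun p : (Fin n → ℝ) × ((Fin k → Fin n) → ℝ) =>
      spike k β (normalizedVector p.1) + p.2 :=
    (hspike.comp measurable_fst).add measurable_snd
  have hshift : Measurable fun (p : EuclideanSpace ℝ (Fin n) × ((Fin k → Fin n) → ℝ))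
      (idx : Fin k → Fin n) => β * (∏ j, p.1 (idx j)) + p.2 idx := by
    fun_prop
  have hprod := Measure.map_prod_map (stdGaussianPi (Fin n)) (stdGaussianPi (Fin k → Fin n))
    (measurable_normalizedVector (n := n)) hT
  rw [spikedSymTensor, hS, hN, hprod, Measure.map_map hshift
    (measurable_normalizedVector.prodMap hT), Measure.map_map hT hadd]
  refine congrArg (fun f => Measure.map f _) ?_
  funext p idx
  exact (scaledSymmetrize_spike_add hn β _ _ _).symm

lemma tvDist_nonneg {Ω : Type*} [MeasurableSpace Ω] (P Q : Measure Ω) : 0 ≤ tvDist P Q :=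
  Real.iSup_nonneg fun _ => abs_nonneg _

lemma tvDist_spikedSymTensor_le {k n : ℕ} (hn : n ≠ 0) (β : ℝ) {δ : ℝ} (hδ : 0 ≤ δ)
    (h : ∫⁻ y, ∫⁻ x, ENNReal.ofReal (Real.exp (n * (β ^ 2 / 2) *
      (∑ i, normalizedVector y i * normalizedVector x i) ^ k))
        ∂stdGaussianPi (Fin n) ∂stdGaussianPi (Fin n) ≤ ENNReal.ofReal (1 + δ)) :
    tvDist (spikedSymTensor k n β) (symNoise k n) ≤ √δ := by
  have hN : symNoise k n = (stdGaussianPi (Fin k → Fin n)).map (scaledSymmetrize k n) := rfl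
  have : Nonempty {s : Set ((Fin k → Fin n) → ℝ) // MeasurableSet s} := ⟨⟨∅, .empty⟩⟩
  refine ciSup_le fun A => ?_
  rw [spikedSymTensor_eq_map hn, hN, Measure.map_apply (measurable_scaledSymmetrize k n) A.2,
    Measure.map_apply (measurable_scaledSymmetrize k n) A.2]
  refine abs_map_prod_add_stdGaussianPi_sub_le (stdGaussianPi (Fin n))
    (measurable_spike_normalizedVector k n β) hδ ?_ (measurable_scaledSymmetrize k n A.2)
  simpa only [sum_spike_mul_spike] using h

lemma ofReal_exp_le_one_add {a a' t : ℝ} {k : ℕ} (ha : 0 ≤ a) (haa' : a ≤ a') :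
    ENNReal.ofReal (Real.exp (a * t ^ k)) ≤
      1 + ENNReal.ofReal (Real.exp (a' * |t| ^ k) - 1) := by
  have h1 : a * t ^ k ≤ a' * |t| ^ k := by
    have h2 : t ^ k ≤ |t| ^ k := by rw [← abs_pow]; exact le_abs_self _
    exact (mul_le_mul_of_nonneg_left h2 ha).trans (by gcongr)
  have h3 : 0 ≤ a' * |t| ^ k := by have := ha.trans haa'; positivity
  rw [← ENNReal.ofReal_one, ← ENNReal.ofReal_add zero_le_one
    (sub_nonneg.2 (Real.one_le_exp h3)), add_sub_cancel]
  exact ENNReal.ofReal_le_ofReal (Real.exp_le_exp.2 h1)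

lemma tvDist_spikedSymTensor_le_sqrt_tail {k : ℕ} (hk : k ≠ 0) {β b₁ b₂ θ p : ℝ} (hβ0 : 0 ≤ β)
    (hβ : β ≤ b₁) (hb₁ : 0 < b₁) (hb₂0 : 0 ≤ b₂) (hb₂ : b₂ ≤ betaBar k) (hθ0 : 0 < θ)
    (hθ1 : θ < 1) {n : ℕ} (hn : 2 ≤ n) (hp : p * (n * b₁ ^ 2) ≤ θ * (n - 1) * b₂ ^ 2)
    (hfin : overlapTailBound k (√(1 - θ))⁻¹ θ (b₁ ^ 2 / 2) p n ≠ ∞) :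
    tvDist (spikedSymTensor k n β) (symNoise k n) ≤
      √(overlapTailBound k (√(1 - θ))⁻¹ θ (b₁ ^ 2 / 2) p n).toReal := by
  refine tvDist_spikedSymTensor_le (by omega) β ENNReal.toReal_nonneg ?_
  rw [ENNReal.ofReal_add zero_le_one ENNReal.toReal_nonneg, ENNReal.ofReal_one,
    ENNReal.ofReal_toReal hfin]
  set I := overlapTailBound k (√(1 - θ))⁻¹ θ (b₁ ^ 2 / 2) p n
  have hbound : ∀ y : Fin n → ℝ, ∫⁻ x, ENNReal.ofReal (Real.exp (n * (β ^ 2 / 2) *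
      (∑ i, normalizedVector y i * normalizedVector x i) ^ k)) ∂stdGaussianPi (Fin n) ≤
        1 + I := by
    intro y
    refine (lintegral_mono fun x => ofReal_exp_le_one_add (a' := n * (b₁ ^ 2 / 2))
      (by positivity) (by gcongr)).trans ?_
    rw [lintegral_add_left measurable_const, lintegral_const, measure_univ, mul_one]
    gcongr
    exact lintegral_exp_overlap_sub_one_le hk hb₁ hb₂0 hb₂ hθ0 hθ1 hn hp y
  refine (lintegral_mono hbound).trans ?_
  rw [lintegral_const, measure_univ, mul_one]

/-- for `k ≥ 3` and `0 ≤ β < β̄_k`, the total variation distance between the law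
of the spiked symmetric tensor `β v^{⊗k} + Z` and the law of `Z` tends to `0`. -/
theorem spiked_tensor_tv_to_zero
    (k : ℕ) (hk : 3 ≤ k) (β : ℝ) (hβ0 : 0 ≤ β) (hβ : β < betaBar k) :
    Tendsto (fun n => tvDist (spikedSymTensor k n β) (symNoise k n)) atTop (nhds 0) := by
  obtain ⟨b₁, hβ₁, hb₁⟩ := exists_between hβ
  obtain ⟨b₂, hb₁₂, hb₂⟩ := exists_between hb₁
  have hb₁0 : 0 < b₁ := hβ0.trans_lt hβ₁
  have hb₂0 : 0 < b₂ := hb₁0.trans hb₁₂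
  have hρ : b₁ ^ 2 / b₂ ^ 2 < 1 := by rw [div_lt_one (by positivity)]; gcongr
  obtain ⟨θ, hρθ, hθ1⟩ := exists_between hρ
  have hθ0 : 0 < θ := lt_trans (by positivity) hρθ
  have hθb : 1 < θ * b₂ ^ 2 / b₁ ^ 2 := by
    rw [one_lt_div (by positivity)]
    rwa [div_lt_iff₀ (by positivity)] at hρθ
  obtain ⟨p, hp1, hp⟩ := exists_between hθb
  rw [lt_div_iff₀ (by positivity)] at hp
  have hlim : Tendsto (overlapTailBound k (√(1 - θ))⁻¹ θ (b₁ ^ 2 / 2) p) atTop (nhds 0) :=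
    tendsto_lintegral_tail_bound hk hθ0 (by positivity) hp1
  have hlim' : Tendsto
      (fun n => √(overlapTailBound k (√(1 - θ))⁻¹ θ (b₁ ^ 2 / 2) p n).toReal)
      atTop (nhds 0) := by
    simpa using ((ENNReal.tendsto_toReal ENNReal.zero_ne_top).comp hlim).sqrt
  have hlarge : ∀ᶠ n : ℕ in atTop, θ * b₂ ^ 2 ≤ (θ * b₂ ^ 2 - p * b₁ ^ 2) * n :=
    (tendsto_natCast_atTop_atTop.const_mul_atTop (sub_pos.2 hp)).eventually_ge_atTop _
  refine squeeze_zero' (Eventually.of_forall fun n => tvDist_nonneg _ _) ?_ hlim'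
  filter_upwards [eventually_ge_atTop 2, hlarge, hlim.eventually_lt_const ENNReal.zero_lt_top]
    with n hn hnp hfin
  exact tvDist_spikedSymTensor_le_sqrt_tail (by omega) hβ0 hβ₁.le hb₁0 hb₂0.le hb₂.le hθ0 hθ1 hn
    (by linarith) hfin.ne

end
end

section
/- Let v be a uniformly random vector on the unit sphere S^{n−1} ⊂ ℝ^n and let ⟨v, e₁⟩ be its first coordinate. Then for any interval [a,b] with −1 ≤ a < b ≤ 1, lim_{n→∞} (1/n) log P(⟨v, e₁⟩ ∈ [a,b]) = max{ (1/2) log(1 − q²) : q ∈ [a,b] }. -/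
open MeasureTheory ProbabilityTheory Filter
open scoped ENNReal

noncomputable section

/-- The first coordinate `⟨v, e₁⟩` of a vector in `ℝⁿ` (junk value `0` if `n = 0`). -/
def firstCoord {n : ℕ} (v : EuclideanSpace ℝ (Fin n)) : ℝ :=
  if h : 0 < n then v ⟨0, h⟩ else 0

/-- The values of the first coordinate `x` for which `x / ‖(x, y)‖ ∈ [a, b]`, where `Y = ‖y‖²`. -/
def coneSlice (a b Y : ℝ) : Set ℝ := {x | x / √(x ^ 2 + Y) ∈ Set.Icc a b}

lemma measurableSet_coneSlice (a b Y : ℝ) : MeasurableSet (coneSlice a b Y) := by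
  have h : Measurable fun x : ℝ => x / √(x ^ 2 + Y) := by fun_prop
  exact h measurableSet_Icc

lemma sphereUniform_firstCoord_eq_lintegral (m : ℕ) (a b : ℝ) :
    sphereUniform (m + 1) {v | firstCoord v ∈ Set.Icc a b} =
      ∫⁻ y, gaussianReal 0 1 (coneSlice a b (∑ i, y i ^ 2)) ∂stdGaussianPi (Fin m) := by
  have hS : MeasurableSet
      {p : ℝ × (Fin m → ℝ) | p.1 / √(p.1 ^ 2 + ∑ i, p.2 i ^ 2) ∈ Set.Icc a b} := by
    have h : Measurable fun p : ℝ × (Fin m → ℝ) => p.1 / √(p.1 ^ 2 + ∑ i, p.2 i ^ 2) := by fun_prop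
    exact h measurableSet_Icc
  have hmp := measurePreserving_piFinSuccAbove (fun _ : Fin (m + 1) => gaussianReal 0 1) 0
  have hT : MeasurableSet {v : EuclideanSpace ℝ (Fin (m + 1)) | firstCoord v ∈ Set.Icc a b} := by
    have h : Measurable fun v : EuclideanSpace ℝ (Fin (m + 1)) => firstCoord v := by
      simp only [firstCoord, Nat.succ_pos, dite_true]
      fun_prop
    exact h measurableSet_Icc
  have hn : Measurable fun v : EuclideanSpace ℝ (Fin (m + 1)) => ‖v‖⁻¹ • v := by fun_prop
  have he : Measurable fun x : Fin (m + 1) → ℝ =>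
      ((EuclideanSpace.equiv (Fin (m + 1)) ℝ).symm x : EuclideanSpace ℝ (Fin (m + 1))) :=
    (EuclideanSpace.equiv (Fin (m + 1)) ℝ).symm.continuous.measurable
  calc sphereUniform (m + 1) {v | firstCoord v ∈ Set.Icc a b}
      = stdGaussianPi (Fin (m + 1)) (MeasurableEquiv.piFinSuccAbove (fun _ => ℝ) 0 ⁻¹'
          {p : ℝ × (Fin m → ℝ) | p.1 / √(p.1 ^ 2 + ∑ i, p.2 i ^ 2) ∈ Set.Icc a b}) := by
        rw [sphereUniform, Measure.map_apply hn hT, Measure.map_apply he (hn hT)]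
        congr 1
        ext x
        simp [firstCoord, EuclideanSpace.norm_eq, Fin.sum_univ_succ, MeasurableEquiv.piFinSuccAbove,
          Fin.insertNthEquiv, Fin.tail, div_eq_inv_mul]
    _ = _ := by
        rw [stdGaussianPi, hmp.measure_preimage hS.nullMeasurableSet, Measure.prod_apply_symm hS]
        rfl

lemma gaussianReal_coneSlice_neg (a b Y : ℝ) :
    gaussianReal 0 1 (coneSlice (-b) (-a) Y) = gaussianReal 0 1 (coneSlice a b Y) := by
  have h : (gaussianReal 0 1).map (fun x : ℝ => -x) = gaussianReal 0 1 := by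
    simpa using gaussianReal_map_neg (μ := 0) (v := 1)
  conv_lhs => rw [← h, Measure.map_apply measurable_neg (measurableSet_coneSlice _ _ _)]
  congr 1
  ext x
  simp [coneSlice, neg_div, and_comm]

lemma sphereUniform_firstCoord_neg (m : ℕ) (a b : ℝ) :
    sphereUniform (m + 1) {v | firstCoord v ∈ Set.Icc (-b) (-a)} =
      sphereUniform (m + 1) {v | firstCoord v ∈ Set.Icc a b} := by
  simp_rw [sphereUniform_firstCoord_eq_lintegral, gaussianReal_coneSlice_neg]

lemma coneSlice_subset_Ici {a b Y : ℝ} (ha : 0 ≤ a) (ha1 : a < 1) (hY : 0 ≤ Y) :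
    coneSlice a b Y ⊆ {x | a / √(1 - a ^ 2) * √Y ≤ x} := by
  rintro x ⟨hx, -⟩
  have h1 : 0 < 1 - a ^ 2 := by nlinarith
  have hx' : a * √(x ^ 2 + Y) ≤ x := by
    rcases (Real.sqrt_nonneg (x ^ 2 + Y)).eq_or_lt with h | h
    · have := Real.sqrt_eq_zero'.1 h.symm
      have : x = 0 := by nlinarith [sq_nonneg x]
      rw [← h]; simp [this]
    · rwa [le_div_iff₀ h] at hx
  have hx0 : 0 ≤ x := le_trans (by positivity) hx'
  have hsq : a ^ 2 * (x ^ 2 + Y) ≤ x ^ 2 := by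
    have := pow_le_pow_left₀ (by positivity) hx' 2
    rwa [mul_pow, Real.sq_sqrt (by positivity)] at this
  refine (sq_le_sq₀ (by positivity) hx0).1 ?_
  rw [mul_pow, div_pow, Real.sq_sqrt h1.le, Real.sq_sqrt hY, div_mul_eq_mul_div, div_le_iff₀ h1]
  linarith

lemma Icc_subset_coneSlice {c d Y : ℝ} (hc : 0 ≤ c) (hc1 : c < 1) (hd : 0 ≤ d) (hd1 : d < 1)
    (hY : 0 < Y) :
    Set.Icc (c / √(1 - c ^ 2) * √Y) (d / √(1 - d ^ 2) * √Y) ⊆ coneSlice c d Y := by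
  rintro x ⟨hx1, hx2⟩
  have hc2 : 0 < 1 - c ^ 2 := by nlinarith
  have hd2 : 0 < 1 - d ^ 2 := by nlinarith
  have hx0 : 0 ≤ x := le_trans (by positivity) hx1
  have h1 := pow_le_pow_left₀ (by positivity) hx1 2
  have h2 := pow_le_pow_left₀ (by positivity) hx2 2
  rw [mul_pow, div_pow, Real.sq_sqrt hc2.le, Real.sq_sqrt hY.le, div_mul_eq_mul_div,
    div_le_iff₀ hc2] at h1
  rw [mul_pow, div_pow, Real.sq_sqrt hd2.le, Real.sq_sqrt hY.le, div_mul_eq_mul_div,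
    le_div_iff₀ hd2] at h2
  have hpos : 0 < √(x ^ 2 + Y) := by positivity
  constructor
  · rw [le_div_iff₀ hpos]
    refine (sq_le_sq₀ (by positivity) hx0).1 ?_
    rw [mul_pow, Real.sq_sqrt (by positivity)]
    linarith
  · rw [div_le_iff₀ hpos]
    refine (sq_le_sq₀ hx0 (by positivity)).1 ?_
    rw [mul_pow, Real.sq_sqrt (by positivity)]
    linarith

lemma gaussianReal_Ici_le {t : ℝ} (ht : 0 ≤ t) :
    gaussianReal 0 1 {x | t ≤ x} ≤ ENNReal.ofReal (Real.exp (-(t ^ 2 / 2))) := by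
  have h := measure_ge_le_exp_mul_mgf (μ := gaussianReal 0 1) (X := id) t ht
    (integrable_exp_mul_gaussianReal t)
  rw [mgf_id_gaussianReal, ← Real.exp_add] at h
  rw [← ENNReal.ofReal_toReal (measure_ne_top (gaussianReal 0 1) {x : ℝ | t ≤ x})]
  refine ENNReal.ofReal_le_ofReal (h.trans_eq ?_)
  congr 1
  simp
  ring

lemma le_gaussianReal_Icc {u w : ℝ} (hu : 0 ≤ u) :
    ENNReal.ofReal ((√(2 * Real.pi))⁻¹ * Real.exp (-(w ^ 2 / 2)) * (w - u)) ≤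
      gaussianReal 0 1 (Set.Icc u w) := by
  rw [gaussianReal_apply _ one_ne_zero, ENNReal.ofReal_mul (by positivity), ← Real.volume_Icc,
    ← setLIntegral_const]
  refine setLIntegral_mono' measurableSet_Icc fun x hx => ?_
  rw [gaussianPDF, gaussianPDFReal]
  refine ENNReal.ofReal_le_ofReal ?_
  have : x ^ 2 ≤ w ^ 2 := pow_le_pow_left₀ (hu.trans hx.1) hx.2 2
  simp only [NNReal.coe_one, mul_one, sub_zero, neg_div]
  gcongr

lemma integral_exp_neg_sq_gaussianReal {d : ℝ} (hd : d ^ 2 < 1) :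
    ∫ x, Real.exp (-((d / √(1 - d ^ 2)) ^ 2 * x ^ 2 / 2)) ∂gaussianReal 0 1 = √(1 - d ^ 2) := by
  have h1 : 0 < 1 - d ^ 2 := by linarith
  rw [integral_gaussianReal_eq_integral_smul one_ne_zero]
  have h : ∀ x : ℝ, gaussianPDFReal 0 1 x • Real.exp (-((d / √(1 - d ^ 2)) ^ 2 * x ^ 2 / 2)) =
      (√(2 * Real.pi))⁻¹ * Real.exp (-(1 / (2 * (1 - d ^ 2))) * x ^ 2) := by
    intro x
    rw [gaussianPDFReal, smul_eq_mul, mul_assoc, ← Real.exp_add, div_pow, Real.sq_sqrt h1.le]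
    simp only [NNReal.coe_one, mul_one, sub_zero]
    congr 2
    field_simp
    ring
  simp_rw [h]
  rw [integral_const_mul, integral_gaussian, ← Real.sqrt_inv, ← Real.sqrt_mul (by positivity)]
  congr 1
  field_simp

lemma integrable_exp_neg_sq_gaussianReal (t : ℝ) :
    Integrable (fun x : ℝ => Real.exp (-(t ^ 2 * x ^ 2 / 2))) (gaussianReal 0 1) := by
  refine Integrable.of_bound (by fun_prop) 1 (ae_of_all _ fun x => ?_)
  rw [Real.norm_eq_abs, Real.abs_exp, Real.exp_le_one_iff]
  have : 0 ≤ t ^ 2 * x ^ 2 / 2 := by positivity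
  linarith

lemma sphereUniform_firstCoord_le {a : ℝ} (b : ℝ) (ha : 0 ≤ a) (ha1 : a < 1) (m : ℕ) :
    sphereUniform (m + 1) {v | firstCoord v ∈ Set.Icc a b} ≤
      ENNReal.ofReal (√(1 - a ^ 2) ^ m) := by
  set t := a / √(1 - a ^ 2) with ht
  have ht0 : 0 ≤ t := by positivity
  have hgi : Integrable (fun y : Fin m → ℝ => ∏ i, Real.exp (-(t ^ 2 * y i ^ 2 / 2)))
      (stdGaussianPi (Fin m)) :=
    Integrable.fintype_prod fun _ => integrable_exp_neg_sq_gaussianReal t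
  rw [sphereUniform_firstCoord_eq_lintegral]
  calc ∫⁻ y, gaussianReal 0 1 (coneSlice a b (∑ i, y i ^ 2)) ∂stdGaussianPi (Fin m)
      ≤ ∫⁻ y, ENNReal.ofReal (∏ i, Real.exp (-(t ^ 2 * y i ^ 2 / 2))) ∂stdGaussianPi (Fin m) := by
        refine lintegral_mono fun y => ?_
        have hY : 0 ≤ ∑ i, y i ^ 2 := by positivity
        refine (measure_mono (coneSlice_subset_Ici ha ha1 hY)).trans
          ((gaussianReal_Ici_le (by positivity)).trans_eq ?_)
        rw [← Real.exp_sum, mul_pow, Real.sq_sqrt hY, Finset.sum_neg_distrib, ← Finset.sum_div,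
          ← Finset.mul_sum]
    _ = ENNReal.ofReal (√(1 - a ^ 2) ^ m) := by
        rw [← ofReal_integral_eq_lintegral_ofReal hgi (ae_of_all _ fun y => by positivity),
          stdGaussianPi,
          integral_fintype_prod_eq_pow (fun x : ℝ => Real.exp (-(t ^ 2 * x ^ 2 / 2))),
          integral_exp_neg_sq_gaussianReal (by nlinarith), Fintype.card_fin]

lemma integral_abs_mul_exp_neg_sq_gaussianReal_pos (t : ℝ) :
    0 < ∫ x, |x| * Real.exp (-(t ^ 2 * x ^ 2 / 2)) ∂gaussianReal 0 1 := by
  have hid : Integrable (fun x : ℝ => x) (gaussianReal 0 1) :=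
    (memLp_id_gaussianReal 1).integrable le_rfl
  have hgi : Integrable (fun x : ℝ => |x| * Real.exp (-(t ^ 2 * x ^ 2 / 2)))
      (gaussianReal 0 1) := by
    refine hid.mono (by fun_prop) (ae_of_all _ fun x => ?_)
    have h : Real.exp (-(t ^ 2 * x ^ 2 / 2)) ≤ 1 := by
      rw [Real.exp_le_one_iff]
      have : 0 ≤ t ^ 2 * x ^ 2 / 2 := by positivity
      linarith
    simpa using mul_le_mul_of_nonneg_left h (abs_nonneg x)
  rw [integral_pos_iff_support_of_nonneg (fun x => by positivity) hgi]
  have hs : Function.support (fun x : ℝ => |x| * Real.exp (-(t ^ 2 * x ^ 2 / 2))) = {0}ᶜ := by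
    ext x
    simp [Real.exp_ne_zero]
  have := nullSingletonClass_gaussianReal (μ := 0) (v := 1) one_ne_zero
  rw [hs, prob_compl_eq_one_sub (measurableSet_singleton 0), measure_singleton]
  simp

lemma exists_pos_mul_pow_le_sphereUniform_firstCoord {c d : ℝ} (hc : 0 ≤ c) (hcd : c < d)
    (hd1 : d < 1) :
    ∃ C : ℝ, 0 < C ∧ ∀ m : ℕ, ENNReal.ofReal (C * √(1 - d ^ 2) ^ m) ≤
      sphereUniform (m + 2) {v | firstCoord v ∈ Set.Icc c d} := by
  have hd : 0 ≤ d := hc.trans hcd.le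
  have hd2 : 0 < 1 - d ^ 2 := by nlinarith
  set t := d / √(1 - d ^ 2) with ht
  set u := c / √(1 - c ^ 2) with hu
  have hu0 : 0 ≤ u := by positivity
  have hut : u < t := by
    refine div_lt_div₀ hcd (Real.sqrt_le_sqrt ?_) hd (by positivity)
    nlinarith
  set K := ∫ x, |x| * Real.exp (-(t ^ 2 * x ^ 2 / 2)) ∂gaussianReal 0 1
  have hK0 : 0 < K := integral_abs_mul_exp_neg_sq_gaussianReal_pos t
  set A := (√(2 * Real.pi))⁻¹ * (t - u) with hA
  have hA0 : 0 < A := mul_pos (by positivity) (sub_pos.2 hut)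
  refine ⟨A * K, by positivity, fun m => ?_⟩
  set g : Fin (m + 1) → ℝ → ℝ := Fin.cons (fun x => |x| * Real.exp (-(t ^ 2 * x ^ 2 / 2)))
    (fun _ x => Real.exp (-(t ^ 2 * x ^ 2 / 2))) with hg
  have hg_int : ∫ y : Fin (m + 1) → ℝ, A * ∏ i, g i (y i) ∂stdGaussianPi (Fin (m + 1)) =
      A * K * √(1 - d ^ 2) ^ m := by
    rw [integral_const_mul, stdGaussianPi, integral_fintype_prod_eq_prod, Fin.prod_univ_succ]
    simp only [hg, Fin.cons_zero, Fin.cons_succ, Finset.prod_const, Finset.card_univ,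
      Fintype.card_fin]
    rw [integral_exp_neg_sq_gaussianReal (by linarith), ← mul_assoc]
  have hg_prod (y : Fin (m + 1) → ℝ) :
      ∏ i, g i (y i) = |y 0| * Real.exp (-(t ^ 2 * (∑ i, y i ^ 2) / 2)) := by
    rw [Fin.prod_univ_succ, Fin.sum_univ_succ]
    simp only [hg, Fin.cons_zero, Fin.cons_succ]
    rw [← Real.exp_sum, mul_assoc, ← Real.exp_add, Finset.sum_neg_distrib, ← Finset.sum_div,
      ← Finset.mul_sum]
    congr 2
    ring
  have hgi : Integrable (fun y : Fin (m + 1) → ℝ => A * ∏ i, g i (y i))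
      (stdGaussianPi (Fin (m + 1))) := by
    refine .of_integral_ne_zero ?_
    rw [hg_int]
    positivity
  rw [sphereUniform_firstCoord_eq_lintegral, ← hg_int,
    ofReal_integral_eq_lintegral_ofReal hgi
      (ae_of_all _ fun y => by simp only [hg_prod]; positivity)]
  refine lintegral_mono fun y => ?_
  rw [hg_prod]
  set Y := ∑ i, y i ^ 2
  have hyY : |y 0| ≤ √Y := by
    rw [← Real.sqrt_sq_eq_abs]
    exact Real.sqrt_le_sqrt
      (Finset.single_le_sum (f := fun i => y i ^ 2) (fun i _ => sq_nonneg _) (Finset.mem_univ 0))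
  have hY : 0 ≤ Y := by positivity
  rcases hY.eq_or_lt with h0 | hYpos
  · have : |y 0| = 0 := le_antisymm (by simpa [← h0] using hyY) (abs_nonneg _)
    simp [this]
  refine le_trans (ENNReal.ofReal_le_ofReal ?_) ((le_gaussianReal_Icc (by positivity)).trans
    (measure_mono (Icc_subset_coneSlice hc (hcd.trans hd1) hd hd1 hYpos)))
  rw [← ht, ← hu, mul_pow, Real.sq_sqrt hY, ← sub_mul, hA]
  have htu : 0 ≤ t - u := (sub_pos.2 hut).le
  calc (√(2 * Real.pi))⁻¹ * (t - u) * (|y 0| * Real.exp (-(t ^ 2 * Y / 2)))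
      ≤ (√(2 * Real.pi))⁻¹ * (t - u) * (√Y * Real.exp (-(t ^ 2 * Y / 2))) := by gcongr
    _ = _ := by ring

/-- A sequence squeezed between exponentials `C r ^ n` (for every `r < s`) and `s ^ n` has
exponential rate `log s`. -/
lemma tendsto_inv_mul_log_of_pow_bounds {p : ℕ → ℝ} {s : ℝ} (hs : 0 < s)
    (hup : ∀ m, p (m + 1) ≤ s ^ m)
    (hlow : ∀ r, 0 < r → r < s → ∃ C : ℝ, 0 < C ∧ ∀ m, C * r ^ m ≤ p (m + 2)) :
    Tendsto (fun n : ℕ => (1 / n : ℝ) * Real.log (p n)) atTop (nhds (Real.log s)) := by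
  have haff (A B : ℝ) : Tendsto (fun m : ℕ => (1 / ((m + 2 : ℕ) : ℝ)) * (A + m * B)) atTop
      (nhds B) := by
    have h0 : Tendsto (fun m : ℕ => (1 / ((m + 2 : ℕ) : ℝ))) atTop (nhds 0) :=
      (tendsto_add_atTop_iff_nat 2).2 tendsto_one_div_atTop_nhds_zero_nat
    have h1 : Tendsto (fun m : ℕ => (1 / ((m + 2 : ℕ) : ℝ)) * (A - 2 * B) + B) atTop (nhds B) := by
      simpa using (h0.mul_const (A - 2 * B)).add_const B
    refine h1.congr fun m => ?_
    push_cast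
    field_simp
    ring
  have hpos (m : ℕ) : 0 < p (m + 2) := by
    obtain ⟨C, hC, h⟩ := hlow (s / 2) (by positivity) (by linarith)
    exact lt_of_lt_of_le (by positivity) (h m)
  rw [← tendsto_add_atTop_iff_nat 2]
  refine tendsto_order.2 ⟨fun L hL => ?_, fun L hL => ?_⟩
  · obtain ⟨l, hLl, hls⟩ := exists_between hL
    obtain ⟨C, hC, h⟩ := hlow (Real.exp l) (Real.exp_pos l) ((Real.lt_log_iff_exp_lt hs).1 hls)
    filter_upwards [(tendsto_order.1 (haff (Real.log C) l)).1 L hLl] with m hm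
    refine hm.trans_le (mul_le_mul_of_nonneg_left ?_ (by positivity))
    have := Real.log_le_log (by positivity) (h m)
    rwa [Real.log_mul hC.ne' (by positivity), Real.log_pow, Real.log_exp] at this
  · filter_upwards [(tendsto_order.1 (haff (Real.log s) (Real.log s))).2 L hL] with m hm
    refine lt_of_le_of_lt (mul_le_mul_of_nonneg_left ?_ (by positivity)) hm
    have := Real.log_le_log (hpos m) (hup (m + 1))
    rw [Real.log_pow] at this
    push_cast at this
    linarith

instance isProbabilityMeasure_sphereUniform (n : ℕ) : IsProbabilityMeasure (sphereUniform n) := by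
  unfold sphereUniform stdGaussianPi
  have := Measure.isProbabilityMeasure_map (μ := Measure.pi fun _ : Fin n => gaussianReal 0 1)
    (f := fun x => ((EuclideanSpace.equiv (Fin n) ℝ).symm x : EuclideanSpace ℝ (Fin n)))
    (EuclideanSpace.equiv (Fin n) ℝ).symm.continuous.measurable.aemeasurable
  exact Measure.isProbabilityMeasure_map (by fun_prop)

lemma tendsto_log_sphereUniform_firstCoord {a b : ℝ} (hab : a < b) (hb : b ≤ 1)
    (hsum : 0 ≤ a + b) :
    Tendsto (fun n : ℕ => (1 / n : ℝ) *
        Real.log ((sphereUniform n {v | firstCoord v ∈ Set.Icc a b}).toReal))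
      atTop (nhds (Real.log √(1 - (max a 0) ^ 2))) := by
  have hqb : max a 0 < b := max_lt hab (by linarith)
  have hq0 : 0 ≤ max a 0 := le_max_right _ _
  have hq1 : max a 0 < 1 := hqb.trans_le hb
  refine tendsto_inv_mul_log_of_pow_bounds (Real.sqrt_pos.2 (by nlinarith)) (fun m => ?_) ?_
  · refine ENNReal.toReal_le_of_le_ofReal (by positivity) ?_
    rcases le_total a 0 with ha | ha
    · simpa [max_eq_right ha] using prob_le_one
    · rw [max_eq_left ha] at hq1 ⊢
      exact sphereUniform_firstCoord_le b ha hq1 m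
  · intro r hr0 hr
    have hcont : ContinuousAt (fun d : ℝ => √(1 - d ^ 2)) (max a 0) := by fun_prop
    have hev : ∀ᶠ d in nhdsWithin (max a 0) (Set.Ioi (max a 0)), r < √(1 - d ^ 2) :=
      (hcont.eventually (lt_mem_nhds hr)).filter_mono nhdsWithin_le_nhds
    obtain ⟨d, hrd, hqd, hdb⟩ := (hev.and (Ioo_mem_nhdsGT hqb)).exists
    obtain ⟨C, hC, h⟩ :=
      exists_pos_mul_pow_le_sphereUniform_firstCoord hq0 hqd (hdb.trans_le hb)
    refine ⟨C, hC, fun m => ?_⟩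
    rw [← ENNReal.ofReal_le_iff_le_toReal (measure_ne_top _ _)]
    calc ENNReal.ofReal (C * r ^ m) ≤ ENNReal.ofReal (C * √(1 - d ^ 2) ^ m) := by gcongr
      _ ≤ _ := h m
      _ ≤ _ := measure_mono fun v hv =>
        Set.Icc_subset_Icc (le_max_left a 0) hdb.le hv

lemma isGreatest_half_log_one_sub_sq {a b : ℝ} (hab : a < b) (hb : b ≤ 1) (hsum : 0 ≤ a + b) :
    IsGreatest {x : ℝ | ∃ q ∈ Set.Icc a b, q ^ 2 < 1 ∧ x = 1 / 2 * Real.log (1 - q ^ 2)}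
      (Real.log √(1 - (max a 0) ^ 2)) := by
  have hqb : max a 0 < b := max_lt hab (by linarith)
  have hq0 : 0 ≤ max a 0 := le_max_right _ _
  have hq1 : (max a 0) ^ 2 < 1 := by nlinarith
  rw [Real.log_sqrt (by linarith)]
  refine ⟨⟨max a 0, ⟨le_max_left _ _, hqb.le⟩, hq1, by ring⟩, ?_⟩
  rintro x ⟨q, ⟨haq, -⟩, hq, rfl⟩
  have hsq : (max a 0) ^ 2 ≤ q ^ 2 := by
    rcases le_total a 0 with ha | ha
    · simpa [max_eq_right ha] using sq_nonneg q
    · rw [max_eq_left ha]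
      exact pow_le_pow_left₀ ha haq 2
  have := Real.log_le_log (by linarith) (show 1 - q ^ 2 ≤ 1 - (max a 0) ^ 2 by linarith)
  linarith

/-- large deviations for the first coordinate of a uniform point on `S^{n−1}`:
`(1/n) log P(⟨v,e₁⟩ ∈ [a,b]) → max{(1/2) log(1−q²) : q ∈ [a,b]}` (with `log 0 = −∞`, so that
the maximum is over those `q ∈ [a,b]` with `q² < 1`). -/
theorem sphere_first_coordinate_ldp
    (a b : ℝ) (ha : -1 ≤ a) (hab : a < b) (hb : b ≤ 1) :
    ∃ M : ℝ,
      IsGreatest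
        {x : ℝ | ∃ q ∈ Set.Icc a b, q ^ 2 < 1 ∧ x = 1 / 2 * Real.log (1 - q ^ 2)} M ∧
      Tendsto (fun n : ℕ => (1 / n : ℝ) *
          Real.log ((sphereUniform n {v | firstCoord v ∈ Set.Icc a b}).toReal))
        atTop (nhds M) := by
  rcases le_total 0 (a + b) with hsum | hsum
  · exact ⟨_, isGreatest_half_log_one_sub_sq hab hb hsum,
      tendsto_log_sphereUniform_firstCoord hab hb hsum⟩
  · have hsum' : 0 ≤ -b + -a := by linarith
    refine ⟨_, ?_, (tendsto_log_sphereUniform_firstCoord (neg_lt_neg hab) (by linarith)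
      hsum').congr' ?_⟩
    · convert isGreatest_half_log_one_sub_sq (neg_lt_neg hab) (by linarith) hsum' using 1
      ext x
      constructor
      · rintro ⟨q, ⟨h1, h2⟩, hq, rfl⟩
        exact ⟨-q, ⟨by linarith, by linarith⟩, by simpa using hq, by simp⟩
      · rintro ⟨q, ⟨h1, h2⟩, hq, rfl⟩
        exact ⟨-q, ⟨by linarith, by linarith⟩, by simpa using hq, by simp⟩
    · filter_upwards [eventually_ge_atTop 1] with n hn
      obtain ⟨m, rfl⟩ := Nat.exists_eq_add_of_le' hn
      rw [sphereUniform_firstCoord_neg]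

end
end
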